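/- Let P and Q be Borel probability measures on ℝ^K having common univariate marginals, and assume each common marginal distribution function F_k(x) := P(π_k ≤ x) is continuous. Let C be the pushforward of P under the map x ↦ (F_1(x_1),…,F_K(x_K)) and C' the corresponding pushforward of Q. Then d_{M_1(ℝ^K)}(P, Q) = d_{M_1([0,1]^K)}(C, C'). -/

import Mathlib

open MeasureTheory Filter
open scoped ENNReal

/-- Integral probability metric generated by a class `F` of functions. -/
noncomputable def ipm {α : Type*} [MeasurableSpace α] (F : Set (α → ℝ))
    (P Q : Measure α) : ℝ :=
  ⨆ f : F, |∫ x, f.1 x ∂P - ∫ x, f.1 x ∂Q|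

/-- The `l_p` distance on `ℝ^K`, `p ∈ [1,∞]` (with the usual modification at `p = ∞`). -/
noncomputable def rp (p : ℝ≥0∞) {K : ℕ} (x y : Fin K → ℝ) : ℝ :=
  if p = ∞ then ⨆ k, |x k - y k|
  else (∑ k, |x k - y k| ^ p.toReal) ^ (1 / p.toReal)

/-- The class `BL_1`: Borel functions with `‖f‖_∞ + ‖f‖_L ≤ 1` w.r.t. the `l_p` metric. -/
def BL1 (p : ℝ≥0∞) (K : ℕ) : Set ((Fin K → ℝ) → ℝ) :=
  { f | Measurable f ∧ ∃ a b : ℝ, 0 ≤ a ∧ 0 ≤ b ∧ a + b ≤ 1 ∧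
      (∀ x, |f x| ≤ a) ∧ ∀ x y, |f x - f y| ≤ b * rp p x y }

/-- The class `M_1`: Borel coordinatewise nondecreasing functions `ℝ^K → [0,1]`. -/
def M1 (K : ℕ) : Set ((Fin K → ℝ) → ℝ) :=
  { f | Measurable f ∧ (∀ x, f x ∈ Set.Icc (0:ℝ) 1) ∧
      ∀ x y : Fin K → ℝ, (∀ k, x k ≤ y k) → f x ≤ f y }

/-- `P` and `Q` have common univariate marginals. -/
def CommonMarginals {K : ℕ} (P Q : Measure (Fin K → ℝ)) : Prop :=
  ∀ k : Fin K, P.map (fun x => x k) = Q.map (fun x => x k)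

/-- The cube `[0,1]^K`, as the type `Fin K → [0,1]`. -/
abbrev Cube (K : ℕ) := Fin K → Set.Icc (0:ℝ) 1

/-- `C` is a copula: each univariate marginal is the uniform (Lebesgue) law on `[0,1]`. -/
def UniformMarginals {K : ℕ} (C : Measure (Cube K)) : Prop :=
  ∀ k : Fin K, C.map (fun w => (w k : ℝ)) = volume.restrict (Set.Icc 0 1)

/-- The class `M_1([0,1]^K)`: Borel coordinatewise nondecreasing functions into `[0,1]`. -/
def M1c (K : ℕ) : Set (Cube K → ℝ) :=
  { f | Measurable f ∧ (∀ u, f u ∈ Set.Icc (0:ℝ) 1) ∧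
      ∀ u v : Cube K, (∀ k, u k ≤ v k) → f u ≤ f v }

/-- The `l_p` distance on `[0,1]^K` (with the usual modification at `p = ∞`). -/
noncomputable def rpc (p : ℝ≥0∞) {K : ℕ} (x y : Cube K) : ℝ :=
  if p = ∞ then ⨆ k, |(x k : ℝ) - (y k : ℝ)|
  else (∑ k, |(x k : ℝ) - (y k : ℝ)| ^ p.toReal) ^ (1 / p.toReal)

/-- The class `BL_1([0,1]^K)` w.r.t. the `l_p` metric. -/
def BL1c (p : ℝ≥0∞) (K : ℕ) : Set (Cube K → ℝ) :=
  { f | Measurable f ∧ ∃ a b : ℝ, 0 ≤ a ∧ 0 ≤ b ∧ a + b ≤ 1 ∧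
      (∀ x, |f x| ≤ a) ∧ ∀ x y, |f x - f y| ≤ b * rpc p x y }

/-- The survival function `C̄(u) = C({w : w_k ≥ u_k ∀k})` of a law on `[0,1]^K`. -/
noncomputable def survival {K : ℕ} (C : Measure (Cube K)) (u : Cube K) : ℝ :=
  (C {w | ∀ k, u k ≤ w k}).toReal
theorem level_null (μ : Measure ℝ) [IsFiniteMeasure μ] (F : ℝ → ℝ)
    (hF : ∀ x, F x = μ.real (Set.Iic x)) (hc : Continuous F) (c : ℝ) :
    μ {x | F x = c} = 0 := by
  have hIcc : ∀ a b, a ≤ b → F a = F b → μ (Set.Icc a b) = 0 := by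
    intro a b hab h
    have h1 : ∀ y < a, μ.real (Set.Icc a b) ≤ F b - F y := by
      intro y hy
      have h2 : μ.real (Set.Icc a b) + μ.real (Set.Iic y) ≤ μ.real (Set.Iic b) := by
        rw [← measureReal_union _ measurableSet_Iic]
        · refine measureReal_mono ?_
          intro z hz
          rcases hz with hz | hz
          · exact hz.2
          · exact le_trans hz (hy.le.trans hab)
        · rw [Set.disjoint_left]
          intro z hz hz'
          exact absurd (hz.1.trans hz') (not_le.2 hy)
      rw [hF b, hF y]; linarith
    have h3 : Tendsto (fun y => F b - F y) (nhdsWithin a (Set.Iio a)) (nhds (F b - F a)) :=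
      ((continuous_const.sub hc).tendsto a).mono_left nhdsWithin_le_nhds
    have h4 : μ.real (Set.Icc a b) ≤ F b - F a :=
      ge_of_tendsto h3 (by filter_upwards [self_mem_nhdsWithin] with y hy using h1 y hy)
    have h5 : μ.real (Set.Icc a b) = 0 :=
      le_antisymm (by linarith) measureReal_nonneg
    exact (measureReal_eq_zero_iff).1 h5
  have hcl : IsClosed {x | F x = c} := isClosed_eq hc continuous_const
  have hsub : {x | F x = c} ⊆ ⋃ n : ℕ, ({x | F x = c} ∩ Set.Icc (-(n:ℝ)) n) := by
    intro x hx
    obtain ⟨n, hn⟩ := exists_nat_ge |x|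
    exact Set.mem_iUnion.2 ⟨n, hx, abs_le.1 hn⟩
  refine measure_mono_null hsub (measure_iUnion_null fun n => ?_)
  rcases Set.eq_empty_or_nonempty ({x | F x = c} ∩ Set.Icc (-(n:ℝ)) n) with he | hne
  · simp [he]
  have hK : IsCompact ({x | F x = c} ∩ Set.Icc (-(n:ℝ)) n) := isCompact_Icc.inter_left hcl
  obtain ⟨a, ha⟩ := hK.exists_isLeast hne
  obtain ⟨b, hb⟩ := hK.exists_isGreatest hne
  refine measure_mono_null (t := Set.Icc a b) (fun x hx => ⟨ha.2 hx, hb.2 hx⟩) ?_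
  exact hIcc a b (ha.2 hb.1) (ha.1.1.trans hb.1.1.symm)

theorem ae_strict (μ : Measure ℝ) [IsFiniteMeasure μ] (F : ℝ → ℝ)
    (hF : ∀ x, F x = μ.real (Set.Iic x)) (hc : Continuous F) :
    ∀ᵐ x ∂μ, ∀ y < x, F y < F x := by
  have hmono : Monotone F := by
    intro x y h
    rw [hF, hF]
    exact measureReal_mono (Set.Iic_subset_Iic.2 h)
  have h : ∀ᵐ x ∂μ, ∀ q : ℚ, F x ≠ F q := by
    rw [ae_all_iff]
    intro q
    rw [ae_iff]
    simpa using level_null μ F hF hc (F q)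
  filter_upwards [h] with x hx y hy
  obtain ⟨q, hq, hq'⟩ := exists_rat_btwn hy
  exact lt_of_le_of_lt (hmono hq.le) (lt_of_le_of_ne (hmono hq'.le) (hx q).symm)

/-- Generalized inverse with values in the extended reals. -/
noncomputable def qinv (F : ℝ → ℝ) (u : ℝ) : EReal :=
  sInf ((fun x : ℝ => (x : EReal)) '' {x | u ≤ F x})

theorem qinv_mono (F : ℝ → ℝ) : Monotone (qinv F) := by
  intro u v h
  exact sInf_le_sInf (Set.image_mono fun x hx => le_trans h hx)

theorem qinv_eq (F : ℝ → ℝ) (x : ℝ) (h : ∀ y < x, F y < F x) :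
    qinv F (F x) = x := by
  apply le_antisymm
  · exact sInf_le ⟨x, le_refl (F x), rfl⟩
  · apply le_sInf
    rintro _ ⟨y, hy, rfl⟩
    by_contra hlt
    have : y < x := by simpa using hlt
    exact absurd (h y this) (not_lt.2 hy)

open Classical in
/-- The pulled back function on the cube. -/
noncomputable def pull {K : ℕ} (F : Fin K → ℝ → ℝ) (f : (Fin K → ℝ) → ℝ) (u : Cube K) : ℝ :=
  if ∃ k, qinv (F k) (u k) = ⊥ then 0
  else if ∃ k, qinv (F k) (u k) = ⊤ then 1
  else f (fun k => (qinv (F k) (u k)).toReal)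

theorem pull_mem {K : ℕ} (F : Fin K → ℝ → ℝ) (f : (Fin K → ℝ) → ℝ) (hf : f ∈ M1 K) :
    pull F f ∈ M1c K := by
  obtain ⟨hm, hb, hmon⟩ := hf
  have hq : ∀ k, Measurable (fun u : Cube K => qinv (F k) (u k)) := fun k =>
    (qinv_mono (F k)).measurable.comp (measurable_subtype_coe.comp (measurable_pi_apply k))
  have hb' : ∀ u, pull F f u ∈ Set.Icc (0:ℝ) 1 := by
    intro u
    unfold pull
    split_ifs
    · simp
    · simp
    · exact hb _
  refine ⟨?_, hb', ?_⟩
  · unfold pull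
    refine Measurable.ite ?_ measurable_const (Measurable.ite ?_ measurable_const ?_)
    · rw [Set.ofPred_exists]
      exact MeasurableSet.iUnion fun k => hq k (measurableSet_singleton _)
    · rw [Set.ofPred_exists]
      exact MeasurableSet.iUnion fun k => hq k (measurableSet_singleton _)
    · exact hm.comp (measurable_pi_lambda _ fun k => (hq k).ereal_toReal)
  · intro u v h
    have hle : ∀ k, qinv (F k) (u k) ≤ qinv (F k) (v k) := fun k => qinv_mono _ (h k)
    by_cases hu : ∃ k, qinv (F k) (u k) = ⊥
    · have : pull F f u = 0 := by unfold pull; rw [if_pos hu]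
      rw [this]; exact (hb' v).1
    have hv : ¬ ∃ k, qinv (F k) (v k) = ⊥ := by
      rintro ⟨k, hk⟩
      exact hu ⟨k, le_bot_iff.1 (hk ▸ hle k)⟩
    by_cases hv2 : ∃ k, qinv (F k) (v k) = ⊤
    · have : pull F f v = 1 := by unfold pull; rw [if_neg hv, if_pos hv2]
      rw [this]; exact (hb' u).2
    have hu2 : ¬ ∃ k, qinv (F k) (u k) = ⊤ := by
      rintro ⟨k, hk⟩
      exact hv2 ⟨k, top_le_iff.1 (hk ▸ hle k)⟩
    unfold pull
    rw [if_neg hu, if_neg hv, if_neg hv2, if_neg hu2]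
    push Not at hu hv2
    exact hmon _ _ fun k => EReal.toReal_le_toReal (hle k) (hu k) (hv2 k)

/-- Lemma 1 (first part): for laws `P`, `Q` on `ℝ^K` with common continuous marginal
distribution functions `F_k`, and `C`, `C'` the pushforwards of `P`, `Q` under
`x ↦ (F_1(x_1),…,F_K(x_K))` (the associated copulas),
`d_{M_1(ℝ^K)}(P,Q) = d_{M_1([0,1]^K)}(C,C')`. Since `F_k` takes values in `[0,1]`,
the map into the cube is written via the (there trivial) clamping `Set.projIcc`. -/
theorem stmt14 (K : ℕ) (P Q : Measure (Fin K → ℝ))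
    [IsProbabilityMeasure P] [IsProbabilityMeasure Q]
    (hm : CommonMarginals P Q)
    (F : Fin K → ℝ → ℝ) (hF : ∀ k x, F k x = (P {y | y k ≤ x}).toReal)
    (hFcont : ∀ k, Continuous (F k)) :
    ipm (M1 K) P Q =
      ipm (M1c K)
        (P.map (fun x k => Set.projIcc (0:ℝ) 1 zero_le_one (F k (x k))))
        (Q.map (fun x k => Set.projIcc (0:ℝ) 1 zero_le_one (F k (x k)))) := by
  have hT : ∀ k x, (Set.projIcc (0:ℝ) 1 zero_le_one (F k x) : ℝ) = F k x := by
    intro k x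
    have : F k x ∈ Set.Icc (0:ℝ) 1 := by
      rw [hF]; exact ⟨measureReal_nonneg, measureReal_le_one⟩
    rw [Set.projIcc_of_mem _ this]
  have hTm : Measurable (fun (x : Fin K → ℝ) k =>
      Set.projIcc (0:ℝ) 1 zero_le_one (F k (x k))) :=
    measurable_pi_lambda _ fun k =>
      (continuous_projIcc.comp ((hFcont k).comp (continuous_apply k))).measurable
  have hmono : ∀ k, Monotone (F k) := by
    intro k x y h
    rw [hF, hF]
    exact measureReal_mono (μ := P) (fun z hz => le_trans hz h)
  have hint : ∀ (ρ : Measure (Fin K → ℝ)) (g : Cube K → ℝ), Measurable g →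
      ∫ u, g u ∂(ρ.map (fun x k => Set.projIcc (0:ℝ) 1 zero_le_one (F k (x k))))
        = ∫ x, g (fun k => Set.projIcc (0:ℝ) 1 zero_le_one (F k (x k))) ∂ρ :=
    fun ρ g hg => integral_map hTm.aemeasurable hg.aestronglyMeasurable
  have haeμ : ∀ k, ∀ᵐ t ∂(P.map (fun x => x k)), ∀ y < t, F k y < F k t := by
    intro k
    haveI : IsProbabilityMeasure (P.map (fun x => x k)) :=
      Measure.isProbabilityMeasure_map (measurable_pi_apply k).aemeasurable
    refine ae_strict _ (F k) (fun x => ?_) (hFcont k)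
    rw [hF, Measure.real, Measure.map_apply (measurable_pi_apply k) measurableSet_Iic]
    rfl
  have key : ∀ (ρ : Measure (Fin K → ℝ)), (∀ k, ρ.map (fun x => x k) = P.map (fun x => x k)) →
      ∀ f : (Fin K → ℝ) → ℝ,
      ∫ x, pull F f (fun k => Set.projIcc (0:ℝ) 1 zero_le_one (F k (x k))) ∂ρ = ∫ x, f x ∂ρ := by
    intro ρ hR f
    apply integral_congr_ae
    have : ∀ᵐ x ∂ρ, ∀ k, ∀ y < x k, F k y < F k (x k) := by
      rw [ae_all_iff]
      intro k
      have h := haeμ k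
      rw [← hR k] at h
      exact ae_of_ae_map (measurable_pi_apply k).aemeasurable h
    filter_upwards [this] with x hx
    have hq : ∀ k, qinv (F k) (Set.projIcc (0:ℝ) 1 zero_le_one (F k (x k)) : ℝ) = x k := by
      intro k
      rw [hT]; exact qinv_eq _ _ (hx k)
    simp [pull, hq]
  unfold ipm
  refine congrArg sSup (Set.ext fun r => ⟨?_, ?_⟩)
  · rintro ⟨⟨f, hf⟩, rfl⟩
    have hp := pull_mem F f hf
    refine ⟨⟨pull F f, hp⟩, ?_⟩
    simp only
    rw [hint P _ hp.1, hint Q _ hp.1, key P (fun _ => rfl), key Q (fun k => (hm k).symm)]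
  · rintro ⟨⟨g, hg⟩, rfl⟩
    refine ⟨⟨fun x => g (fun k => Set.projIcc (0:ℝ) 1 zero_le_one (F k (x k))),
      hg.1.comp hTm, fun x => hg.2.1 _, fun x y h => hg.2.2 _ _ fun k =>
        Set.monotone_projIcc _ (hmono k (h k))⟩, ?_⟩
    simp only
    rw [hint P _ hg.1, hint Q _ hg.1]
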